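/- arXiv:1602.07328 — 3 statements merged into one kernel-verified Lean document; each statement's English description precedes it below -/
import Mathlib

section
/- Let C be an abelian category, X a class of objects of C closed under extensions, and ω a class of objects closed under direct summands in C which is X-injective and a relative cogenerator in X. Then ω^∧ = X^⊥ ∩ X^∧. -/
/-!
Common definitions for Auslander–Buchweitz approximation theory in abelian
categories, following Becerril–Mendoza–Pérez–Santiago.
-/

open CategoryTheory CategoryTheory.Limits ZeroObject

universe w v u

namespace ABFormal

variable {C : Type u} [Category.{v} C] [Abelian C] [CategoryTheory.HasExt.{w} C]

/-- `0 → A → B → C' → 0` is a short exact sequence in `C`. -/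
def IsShortExactSeq {A B C' : C} (f : A ⟶ B) (g : B ⟶ C') : Prop :=
  ∃ w : f ≫ g = 0, (ShortComplex.mk f g w).ShortExact

/-- `ωω` is `XX`-injective: `Ext^i(X, W) = 0` for all `X ∈ XX`, `W ∈ ωω` and `i > 0`. -/
def IsRelInjective (XX ωω : Set C) : Prop :=
  ∀ W ∈ ωω, ∀ X ∈ XX, ∀ i : ℕ, 0 < i → Subsingleton (Abelian.Ext.{w} X W i)

/-- `ωω` is `XX`-projective: `Ext^i(W, X) = 0` for all `X ∈ XX`, `W ∈ ωω` and `i > 0`. -/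
def IsRelProjective (XX ωω : Set C) : Prop :=
  ∀ W ∈ ωω, ∀ X ∈ XX, ∀ i : ℕ, 0 < i → Subsingleton (Abelian.Ext.{w} W X i)

/-- `ωω` is a relative cogenerator in `XX`. -/
def IsRelCogenerator (XX ωω : Set C) : Prop :=
  ωω ⊆ XX ∧ ∀ X ∈ XX, ∃ (W X' : C) (i : X ⟶ W) (p : W ⟶ X'),
    W ∈ ωω ∧ X' ∈ XX ∧ IsShortExactSeq i p

/-- `ωω` is a relative generator in `XX`. -/
def IsRelGenerator (XX ωω : Set C) : Prop :=
  ωω ⊆ XX ∧ ∀ X ∈ XX, ∃ (X' W : C) (i : X' ⟶ W) (p : W ⟶ X),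
    W ∈ ωω ∧ X' ∈ XX ∧ IsShortExactSeq i p

/-- `id_XX(M) ≤ n` : `Ext^j(X, M) = 0` for all `X ∈ XX` and `j > n`. -/
def relInjDimLE (XX : Set C) (M : C) (n : ℕ) : Prop :=
  ∀ X ∈ XX, ∀ j : ℕ, n < j → Subsingleton (Abelian.Ext.{w} X M j)

/-- The relative injective dimension `id_XX(M) : ℕ∞`. -/
noncomputable def relInjDim (XX : Set C) (M : C) : ℕ∞ :=
  sInf {m : ℕ∞ | ∃ n : ℕ, m = (n : ℕ∞) ∧ relInjDimLE XX M n}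

/-- `pd_XX(M) ≤ n` : `Ext^j(M, X) = 0` for all `X ∈ XX` and `j > n`. -/
def relProjDimLE (XX : Set C) (M : C) (n : ℕ) : Prop :=
  ∀ X ∈ XX, ∀ j : ℕ, n < j → Subsingleton (Abelian.Ext.{w} M X j)

/-- The relative projective dimension `pd_XX(M) : ℕ∞`. -/
noncomputable def relProjDim (XX : Set C) (M : C) : ℕ∞ :=
  sInf {m : ℕ∞ | ∃ n : ℕ, m = (n : ℕ∞) ∧ relProjDimLE XX M n}

/-- There is an exact sequence `0 → X_n → ⋯ → X_0 → M → 0` with all `X_i ∈ XX`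
(a resolution of length `n`). -/
inductive HasResolutionLength (XX : Set C) : ℕ → C → Prop
  | zero {M X : C} (hX : X ∈ XX) (e : X ≅ M) : HasResolutionLength XX 0 M
  | succ {n : ℕ} {M : C} (K X : C) (hX : X ∈ XX)
      (i : K ⟶ X) (p : X ⟶ M) (hse : IsShortExactSeq i p)
      (hK : HasResolutionLength XX n K) : HasResolutionLength XX (n + 1) M

/-- The `XX`-resolution dimension `resdim_XX(M) : ℕ∞`. -/
noncomputable def resDim (XX : Set C) (M : C) : ℕ∞ :=
  sInf {m : ℕ∞ | ∃ n : ℕ, m = (n : ℕ∞) ∧ HasResolutionLength XX n M}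

/-- `XX^∧`, the class of objects with a finite `XX`-resolution. -/
def resHat (XX : Set C) : Set C :=
  {M | ∃ n : ℕ, HasResolutionLength XX n M}

/-- There is an exact sequence `0 → M → X^0 → ⋯ → X^n → 0` with all `X^i ∈ XX`
(a coresolution of length `n`). -/
inductive HasCoresolutionLength (XX : Set C) : ℕ → C → Prop
  | zero {M X : C} (hX : X ∈ XX) (e : M ≅ X) : HasCoresolutionLength XX 0 M
  | succ {n : ℕ} {M : C} (X Q : C) (hX : X ∈ XX)
      (i : M ⟶ X) (p : X ⟶ Q) (hse : IsShortExactSeq i p)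
      (hQ : HasCoresolutionLength XX n Q) : HasCoresolutionLength XX (n + 1) M

/-- The `XX`-coresolution dimension `coresdim_XX(M) : ℕ∞`. -/
noncomputable def coresDim (XX : Set C) (M : C) : ℕ∞ :=
  sInf {m : ℕ∞ | ∃ n : ℕ, m = (n : ℕ∞) ∧ HasCoresolutionLength XX n M}

/-- `XX^∨`, the class of objects with a finite `XX`-coresolution. -/
def coresVee (XX : Set C) : Set C :=
  {M | ∃ n : ℕ, HasCoresolutionLength XX n M}

/-- `IsSyzygyOf XX n M K` : there is an exact sequence
`0 → K → X_{n-1} → ⋯ → X_0 → M → 0` with all `X_i ∈ XX`. -/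
inductive IsSyzygyOf (XX : Set C) : ℕ → C → C → Prop
  | zero {M K : C} (e : K ≅ M) : IsSyzygyOf XX 0 M K
  | succ {n : ℕ} {M : C} (K X L : C) (hX : X ∈ XX)
      (i : K ⟶ X) (p : X ⟶ L) (hse : IsShortExactSeq i p)
      (hL : IsSyzygyOf XX n M L) : IsSyzygyOf XX (n + 1) M K

/-- `XX^⊥ = {N | Ext^i(X, N) = 0 for all X ∈ XX, i > 0}`. -/
def rightPerp (XX : Set C) : Set C :=
  {N | ∀ X ∈ XX, ∀ i : ℕ, 0 < i → Subsingleton (Abelian.Ext.{w} X N i)}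

/-- `XX^{⊥₁} = {N | Ext^1(X, N) = 0 for all X ∈ XX}`. -/
def rightPerp1 (XX : Set C) : Set C :=
  {N | ∀ X ∈ XX, Subsingleton (Abelian.Ext.{w} X N 1)}

/-- `^⊥XX = {N | Ext^i(N, X) = 0 for all X ∈ XX, i > 0}`. -/
def leftPerp (XX : Set C) : Set C :=
  {N | ∀ X ∈ XX, ∀ i : ℕ, 0 < i → Subsingleton (Abelian.Ext.{w} N X i)}

/-- `^{⊥₁}XX = {N | Ext^1(N, X) = 0 for all X ∈ XX}`. -/
def leftPerp1 (XX : Set C) : Set C :=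
  {N | ∀ X ∈ XX, Subsingleton (Abelian.Ext.{w} N X 1)}

/-- Closed under extensions. -/
def ClosedUnderExtensions (XX : Set C) : Prop :=
  ∀ ⦃A B C' : C⦄ (f : A ⟶ B) (g : B ⟶ C'), IsShortExactSeq f g →
    A ∈ XX → C' ∈ XX → B ∈ XX

/-- Closed under kernels of epimorphisms between objects of the class. -/
def ClosedUnderKernelsOfEpis (XX : Set C) : Prop :=
  ∀ ⦃A B C' : C⦄ (f : A ⟶ B) (g : B ⟶ C'), IsShortExactSeq f g →
    B ∈ XX → C' ∈ XX → A ∈ XX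

/-- Closed under cokernels of monomorphisms between objects of the class. -/
def ClosedUnderCokernelsOfMonos (XX : Set C) : Prop :=
  ∀ ⦃A B C' : C⦄ (f : A ⟶ B) (g : B ⟶ C'), IsShortExactSeq f g →
    A ∈ XX → B ∈ XX → C' ∈ XX

/-- Closed under direct summands (retracts) in `C`. -/
def ClosedUnderSummands (XX : Set C) : Prop :=
  ∀ ⦃X A : C⦄, X ∈ XX → ∀ (s : A ⟶ X) (r : X ⟶ A), s ≫ r = 𝟙 A → A ∈ XX

/-- Pre-resolving class: closed under extensions and kernels of epimorphisms. -/
def IsPreresolving (XX : Set C) : Prop :=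
  ClosedUnderExtensions XX ∧ ClosedUnderKernelsOfEpis XX

/-- Pre-coresolving class: closed under extensions and cokernels of monomorphisms. -/
def IsPrecoresolving (XX : Set C) : Prop :=
  ClosedUnderExtensions XX ∧ ClosedUnderCokernelsOfMonos XX

/-- Left thick class. -/
def IsLeftThick (XX : Set C) : Prop :=
  IsPreresolving XX ∧ ClosedUnderSummands XX

/-- Right thick class. -/
def IsRightThick (XX : Set C) : Prop :=
  IsPrecoresolving XX ∧ ClosedUnderSummands XX

/-- Thick class. -/
def IsThickClass (XX : Set C) : Prop :=
  IsLeftThick XX ∧ IsRightThick XX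

/-- The smallest thick class of `C` containing `S`. -/
def thickClosure (S : Set C) : Set C :=
  ⋂₀ {T : Set C | IsThickClass T ∧ S ⊆ T}

/-- The class of projective objects of `C`. -/
def ProjClass (C : Type u) [Category.{v} C] : Set C := {P | Projective P}

/-- The class of injective objects of `C`. -/
def InjClass (C : Type u) [Category.{v} C] : Set C := {I | Injective I}

/-- Resolving class in `C`: pre-resolving and containing all projectives. -/
def IsResolvingClass (XX : Set C) : Prop :=
  IsPreresolving XX ∧ ProjClass C ⊆ XX

/-- Coresolving class in `C`: pre-coresolving and containing all injectives. -/
def IsCoresolvingClass (XX : Set C) : Prop :=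
  IsPrecoresolving XX ∧ InjClass C ⊆ XX

/-- A left Frobenius pair `(XX, ωω)` in `C`. -/
structure LeftFrobeniusPair (XX ωω : Set C) : Prop where
  leftThick : IsLeftThick XX
  relInj : IsRelInjective XX ωω
  relCogen : IsRelCogenerator XX ωω
  summands : ClosedUnderSummands ωω

/-- A strong left Frobenius pair `(XX, ωω)` in `C`. -/
structure StrongLeftFrobeniusPair (XX ωω : Set C) extends LeftFrobeniusPair XX ωω : Prop where
  relProj : IsRelProjective XX ωω
  relGen : IsRelGenerator XX ωω

/-- A right Frobenius pair `(νν, YY)` in `C`. -/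
structure RightFrobeniusPair (νν YY : Set C) : Prop where
  rightThick : IsRightThick YY
  relProj : IsRelProjective YY νν
  relGen : IsRelGenerator YY νν
  summands : ClosedUnderSummands νν

/-- `φ : X ⟶ M` is an `XX`-precover of `M`. -/
def IsPrecover (XX : Set C) {X M : C} (φ : X ⟶ M) : Prop :=
  X ∈ XX ∧ ∀ (X' : C), X' ∈ XX → ∀ f : X' ⟶ M, ∃ h : X' ⟶ X, h ≫ φ = f

/-- `φ : M ⟶ Y` is an `XX`-preenvelope of `M`. -/
def IsPreenvelope (XX : Set C) {M Y : C} (φ : M ⟶ Y) : Prop :=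
  Y ∈ XX ∧ ∀ (Y' : C), Y' ∈ XX → ∀ f : M ⟶ Y', ∃ h : Y ⟶ Y', φ ≫ h = f

/-- A left `S`-cotorsion pair `(F, G)` in `C`. -/
def IsLeftCotorsionPair (S F G : Set C) : Prop :=
  F ⊆ S ∧ G ⊆ S ∧
  F = {A | A ∈ S ∧ ∀ G' ∈ G, Subsingleton (Abelian.Ext.{w} A G' 1)} ∧
  ∀ s ∈ S, ∃ (G' F' : C) (i : G' ⟶ F') (p : F' ⟶ s),
    G' ∈ G ∧ F' ∈ F ∧ IsShortExactSeq i p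

/-- A right `S`-cotorsion pair `(F, G)` in `C`. -/
def IsRightCotorsionPair (S F G : Set C) : Prop :=
  F ⊆ S ∧ G ⊆ S ∧
  G = {A | A ∈ S ∧ ∀ F' ∈ F, Subsingleton (Abelian.Ext.{w} F' A 1)} ∧
  ∀ s ∈ S, ∃ (G' F' : C) (i : s ⟶ G') (p : G' ⟶ F'),
    G' ∈ G ∧ F' ∈ F ∧ IsShortExactSeq i p

/-- An `S`-cotorsion pair `(F, G)` in `C`. -/
def IsCotorsionPair (S F G : Set C) : Prop :=
  IsLeftCotorsionPair S F G ∧ IsRightCotorsionPair S F G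

/-- A left weak AB context `(AA, BB)` in `C`. -/
structure LeftWeakABContext (AA BB : Set C) : Prop where
  frob : LeftFrobeniusPair AA (AA ∩ BB)
  rightThick : IsRightThick BB
  sub : BB ⊆ resHat AA

omit [HasExt.{w} C] in
lemma resHat_mono {XX YY : Set C} (h : XX ⊆ YY) : resHat XX ⊆ resHat YY := by
  rintro M ⟨n, hM⟩
  refine ⟨n, ?_⟩
  induction hM with
  | zero hX e => exact .zero (h hX) e
  | succ K X hX i p hse _ ih => exact .succ K X (h hX) i p hse ih

omit [HasExt.{w} C] in
lemma mem_resHat_of_shortExact {XX : Set C} {K X M : C} {i : K ⟶ X} {p : X ⟶ M}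
    (hse : IsShortExactSeq i p) (hK : K ∈ resHat XX) (hX : X ∈ XX) : M ∈ resHat XX := by
  obtain ⟨n, hn⟩ := hK
  exact ⟨n + 1, .succ K X hX i p hse hn⟩

omit [HasExt.{w} C] in
lemma IsShortExactSeq.of_isColimit {A B Q : C} (f : A ⟶ B) (g : B ⟶ Q) [Mono f] (w : f ≫ g = 0)
    (h : IsColimit (CokernelCofork.ofπ g w)) : IsShortExactSeq f g := by
  refine ⟨w, ?_⟩
  have : Epi g := Cofork.IsColimit.epi h
  exact .mk' (ShortComplex.exact_of_g_is_cokernel _ h) ‹_› ‹_›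

omit [HasExt.{w} C] in
/-- The pushout of a short exact sequence along a morphism out of its left term. -/
lemma IsShortExactSeq.exists_of_isPushout {A B Q A' E : C} {i : A ⟶ B} {p : B ⟶ Q} {f : A ⟶ A'}
    {b : B ⟶ E} {c : A' ⟶ E} (hse : IsShortExactSeq i p) (sq : IsPushout i f b c) :
    ∃ q : E ⟶ Q, IsShortExactSeq c q := by
  obtain ⟨w, hS⟩ := hse
  have : Mono i := hS.mono_f
  have : Epi p := hS.epi_g
  have : Mono c := (MorphismProperty.monomorphisms C).of_isPushout sq.flip ‹Mono i›
  have hq : i ≫ p = f ≫ (0 : A' ⟶ Q) := by simp [w]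
  refine ⟨sq.desc p 0 hq, .of_isColimit _ _ (sq.inr_desc _ _ _) ?_⟩
  refine CokernelCofork.IsColimit.ofπ _ _
    (fun g hg => hS.gIsCokernel.desc (CokernelCofork.ofπ (b ≫ g) ?_))
    (fun g hg => ?_) (fun g hg m hm => ?_)
  · simp [sq.w_assoc, hg]
  · refine sq.hom_ext ?_ (by simp [hg])
    rw [sq.inl_desc_assoc]
    exact hS.gIsCokernel.fac _ WalkingParallelPair.one
  · rw [← cancel_epi p]
    refine Eq.trans ?_ (hS.gIsCokernel.fac
      (CokernelCofork.ofπ (b ≫ g) (by simp [sq.w_assoc, hg])) WalkingParallelPair.one).symm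
    simp [← hm]

omit [HasExt.{w} C] in
/-- The pushout of an epimorphism along a monomorphism has the same kernel. -/
lemma IsShortExactSeq.of_isPushout_of_mono {K A L W H : C} {k : K ⟶ A} {p : A ⟶ L} {i : A ⟶ W}
    {b : W ⟶ H} {c : L ⟶ H} [Mono i] (hse : IsShortExactSeq k p) (sq : IsPushout i p b c) :
    IsShortExactSeq (k ≫ i) b := by
  obtain ⟨w, hS⟩ := hse
  have : Mono k := hS.mono_f
  have : Epi p := hS.epi_g
  have hw : (k ≫ i) ≫ b = 0 := by rw [Category.assoc, sq.w, reassoc_of% w, zero_comp]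
  have key {Z : C} (g : W ⟶ Z) (hg : (k ≫ i) ≫ g = 0) : ∃ l : L ⟶ Z, p ≫ l = i ≫ g :=
    ⟨hS.gIsCokernel.desc (CokernelCofork.ofπ (i ≫ g) (by simpa using hg)),
      hS.gIsCokernel.fac _ WalkingParallelPair.one⟩
  refine .of_isColimit _ _ hw ?_
  have : Epi b := (MorphismProperty.epimorphisms C).of_isPushout sq ‹Epi p›
  exact CokernelCofork.IsColimit.ofπ _ _
    (fun g hg => sq.desc g (key g hg).choose (key g hg).choose_spec.symm)
    (fun g hg => sq.inl_desc _ _ _)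
    (fun g hg m hm => by rw [← cancel_epi b, hm, sq.inl_desc])

omit [HasExt.{w} C] in
lemma IsRelCogenerator.zero_mem {XX ωω : Set C} (hcog : IsRelCogenerator XX ωω)
    (hsum : ClosedUnderSummands ωω) (hne : XX.Nonempty) : (0 : C) ∈ ωω := by
  obtain ⟨X, hX⟩ := hne
  obtain ⟨W, _, _, _, hW, _⟩ := hcog.2 X hX
  exact hsum hW 0 0 (by simp)

omit [HasExt.{w} C] in
/-- Auslander–Buchweitz approximation: an object with a finite `XX`-resolution is the quotient of
an object of `XX` by an object with a finite `ωω`-resolution. -/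
lemma exists_approximation {XX ωω : Set C} (hext : ClosedUnderExtensions XX)
    (hsum : ClosedUnderSummands ωω) (hcog : IsRelCogenerator XX ωω) {M : C} (hM : M ∈ resHat XX) :
    ∃ (K X : C) (i : K ⟶ X) (p : X ⟶ M), K ∈ resHat ωω ∧ X ∈ XX ∧ IsShortExactSeq i p := by
  obtain ⟨n, hM⟩ := hM
  induction hM with
  | @zero M X hX e =>
    refine ⟨0, X, 0, e.hom, ⟨0, .zero (hcog.zero_mem hsum ⟨X, hX⟩) (Iso.refl _)⟩, hX,
      zero_comp, ?_⟩
    exact .mk' ((ShortComplex.exact_iff_mono _ rfl).2 (inferInstanceAs (Mono e.hom)))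
      inferInstance (inferInstanceAs (Epi e.hom))
  | @succ n M L X₀ hX₀ j q hse _ ih =>
    obtain ⟨K, X₁, k, p, hK, hX₁, hkp⟩ := ih
    obtain ⟨W, X', i, r, hW, hX', hir⟩ := hcog.2 X₁ hX₁
    have : Mono i := hir.choose_spec.mono_f
    have sqH := IsPushout.of_hasPushout i p
    obtain ⟨s, hs⟩ := hir.exists_of_isPushout sqH
    have hH : pushout i p ∈ resHat ωω :=
      mem_resHat_of_shortExact (hkp.of_isPushout_of_mono sqH) hK hW
    have sqE := IsPushout.of_hasPushout j (pushout.inr i p)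
    obtain ⟨t, ht⟩ := hse.exists_of_isPushout sqE
    obtain ⟨t', ht'⟩ := hs.exists_of_isPushout sqE.flip
    exact ⟨_, _, _, t, hH, hext _ _ ht' hX₀ hX', ht⟩

lemma rightPerp_of_shortExact {XX : Set C} {K X M : C} {i : K ⟶ X} {p : X ⟶ M}
    (hse : IsShortExactSeq i p) (hK : K ∈ rightPerp.{w} XX) (hX : X ∈ rightPerp.{w} XX) :
    M ∈ rightPerp.{w} XX := by
  obtain ⟨_, hS⟩ := hse
  intro Y hY n hn
  have := hK Y hY (n + 1) n.succ_pos
  have := hX Y hY n hn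
  refine subsingleton_of_forall_eq 0 fun x => ?_
  obtain ⟨y, hy⟩ := Abelian.Ext.covariant_sequence_exact₃ Y hS x rfl (Subsingleton.elim _ _)
  rw [← hy, Subsingleton.elim y 0, Abelian.Ext.zero_comp]

lemma rightPerp_middle_of_shortExact {XX : Set C} {K X M : C} {i : K ⟶ X} {p : X ⟶ M}
    (hse : IsShortExactSeq i p) (hK : K ∈ rightPerp.{w} XX) (hM : M ∈ rightPerp.{w} XX) :
    X ∈ rightPerp.{w} XX := by
  obtain ⟨_, hS⟩ := hse
  intro Y hY n hn
  have := hK Y hY n hn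
  have := hM Y hY n hn
  refine subsingleton_of_forall_eq 0 fun x => ?_
  obtain ⟨y, hy⟩ := Abelian.Ext.covariant_sequence_exact₂ Y hS x (Subsingleton.elim _ _)
  rw [← hy, Subsingleton.elim y 0, Abelian.Ext.zero_comp]

lemma IsRelInjective.resHat_subset_rightPerp {XX ωω : Set C} (hinj : IsRelInjective.{w} XX ωω) :
    resHat ωω ⊆ rightPerp.{w} XX := by
  rintro M ⟨n, hM⟩
  induction hM with
  | @zero M W hW e =>
    intro X hX n hn
    have := hinj W hW X hX n hn
    refine subsingleton_of_forall_eq 0 fun x => ?_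
    rw [← Abelian.Ext.comp_mk₀_id x, ← e.inv_hom_id, ← Abelian.Ext.mk₀_comp_mk₀,
      ← Abelian.Ext.comp_assoc_of_third_deg_zero,
      Subsingleton.elim (x.comp (Abelian.Ext.mk₀ e.inv) (add_zero n)) 0, Abelian.Ext.zero_comp]
  | succ K W hW i p hse _ ih => exact rightPerp_of_shortExact hse ih (hinj W hW)

/-- A short exact sequence with vanishing `Ext¹` has a retraction. -/
lemma IsShortExactSeq.exists_retraction {A B Q : C} {i : A ⟶ B} {p : B ⟶ Q}
    (hse : IsShortExactSeq i p) (h : Subsingleton (Abelian.Ext.{w} Q A 1)) :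
    ∃ r : B ⟶ A, i ≫ r = 𝟙 A := by
  obtain ⟨_, hS⟩ := hse
  obtain ⟨x, hx⟩ := Abelian.Ext.contravariant_sequence_exact₁ hS A
    (Abelian.Ext.mk₀ (𝟙 A)) (add_zero 1) (Subsingleton.elim _ _)
  obtain ⟨r, rfl⟩ := Abelian.Ext.mk₀_bijective _ _ |>.2 x
  refine ⟨r, (Abelian.Ext.mk₀_bijective A A).1 ?_⟩
  rw [← Abelian.Ext.mk₀_comp_mk₀]
  exact hx

lemma IsRelCogenerator.mem_of_mem_rightPerp {XX ωω : Set C} (hcog : IsRelCogenerator XX ωω)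
    (hsum : ClosedUnderSummands ωω) {X : C} (hX : X ∈ XX) (hX' : X ∈ rightPerp.{w} XX) :
    X ∈ ωω := by
  obtain ⟨W, X', i, p, hW, hmem, hse⟩ := hcog.2 X hX
  obtain ⟨r, hr⟩ := hse.exists_retraction (hX' X' hmem 1 one_pos)
  exact hsum hW i r hr

/-- Proposition AB11. If `X` is closed under extensions and `ω` is
closed under direct summands, `X`-injective and a relative cogenerator in `X`, then
`ω^∧ = X^⊥ ∩ X^∧`. -/
theorem stmt8 (XX ωω : Set C) (hext : ClosedUnderExtensions XX)
    (hsum : ClosedUnderSummands ωω) (hinj : IsRelInjective XX ωω)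
    (hcog : IsRelCogenerator XX ωω) :
    resHat ωω = rightPerp XX ∩ resHat XX := by
  refine subset_antisymm
    (Set.subset_inter hinj.resHat_subset_rightPerp (resHat_mono hcog.1)) ?_
  rintro M ⟨hM, hM'⟩
  obtain ⟨K, X, i, p, hK, hX, hse⟩ := exists_approximation hext hsum hcog hM'
  exact mem_resHat_of_shortExact hse hK (hcog.mem_of_mem_rightPerp hsum hX
    (rightPerp_middle_of_shortExact hse (hinj.resHat_subset_rightPerp hK) hM))

end ABFormal
end

section
/- Let (X,ω) be a left Frobenius pair in an abelian category C. Then X^∧ ∩ ^⊥ω = X = X^∧ ∩ ^⊥(ω^∧). -/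
/-!
Common definitions for Auslander–Buchweitz approximation theory in abelian
categories, following Becerril–Mendoza–Pérez–Santiago.
-/

open CategoryTheory CategoryTheory.Limits ZeroObject

universe w v u

namespace ABFormal

variable {C : Type u} [Category.{v} C] [Abelian C] [CategoryTheory.HasExt.{w} C]

/-- In a short exact sequence `0 → K → Y → M → 0`, `Ext^n(X, Y) = 0` and `Ext^{n+1}(X, K) = 0`
imply `Ext^n(X, M) = 0`. -/
lemma subsingleton_ext_X₃ {S : ShortComplex C} (hS : S.ShortExact) {X : C} {n : ℕ}
    (h₂ : Subsingleton (Abelian.Ext.{w} X S.X₂ n))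
    (h₁ : Subsingleton (Abelian.Ext.{w} X S.X₁ (n + 1))) :
    Subsingleton (Abelian.Ext.{w} X S.X₃ n) := by
  refine subsingleton_of_forall_eq 0 fun x => ?_
  obtain ⟨y, rfl⟩ := Abelian.Ext.covariant_sequence_exact₃ X hS x rfl (Subsingleton.elim _ _)
  rw [Subsingleton.elim y 0, Abelian.Ext.zero_comp]

/-- In a short exact sequence `0 → K → X → M → 0`, `Ext^n(X, Y) = 0` and `Ext^{n+1}(M, Y) = 0`
imply `Ext^n(K, Y) = 0`. -/
lemma subsingleton_ext_X₁ {S : ShortComplex C} (hS : S.ShortExact) {Y : C} {n : ℕ}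
    (h₂ : Subsingleton (Abelian.Ext.{w} S.X₂ Y n))
    (h₃ : Subsingleton (Abelian.Ext.{w} S.X₃ Y (n + 1))) :
    Subsingleton (Abelian.Ext.{w} S.X₁ Y n) := by
  have h₃' : Subsingleton (Abelian.Ext.{w} S.X₃ Y (1 + n)) := by rwa [add_comm]
  refine subsingleton_of_forall_eq 0 fun x => ?_
  obtain ⟨y, rfl⟩ := Abelian.Ext.contravariant_sequence_exact₁ hS Y x rfl (Subsingleton.elim _ _)
  rw [Subsingleton.elim y 0, Abelian.Ext.comp_zero]

/-- If `Ext^1(M, W) = 0`, morphisms to `W` extend along a monomorphism with cokernel `M`. -/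
lemma exists_extension {S : ShortComplex C} (hS : S.ShortExact) {W : C}
    (h₃ : Subsingleton (Abelian.Ext.{w} S.X₃ W 1))
    (j : S.X₁ ⟶ W) : ∃ a : S.X₂ ⟶ W, S.f ≫ a = j := by
  obtain ⟨y, hy⟩ := Abelian.Ext.contravariant_sequence_exact₁ hS W (Abelian.Ext.mk₀ j) (add_zero 1)
    (Subsingleton.elim _ _)
  obtain ⟨a, rfl⟩ := (Abelian.Ext.mk₀_bijective _ _).2 y
  exact ⟨a, (Abelian.Ext.mk₀_bijective _ _).1 (by rw [← hy, Abelian.Ext.mk₀_comp_mk₀])⟩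

omit [CategoryTheory.HasExt.{w} C] in
/-- A morphism of short exact sequences which is the identity on the left terms induces
a short exact sequence `0 → X → M ⊞ W → K' → 0`. -/
lemma isShortExactSeq_biprod {K X M W K' : C} {i : K ⟶ X} {p : X ⟶ M} {j : K ⟶ W} {q : W ⟶ K'}
    (h : IsShortExactSeq i p) (h' : IsShortExactSeq j q) {a : X ⟶ W} {b : M ⟶ K'}
    (ha : i ≫ a = j) (hb : p ≫ b = a ≫ q) :
    IsShortExactSeq (biprod.lift p (-a)) (biprod.desc b q) := by
  obtain ⟨w, hS⟩ := h
  obtain ⟨w', hS'⟩ := h'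
  have : Mono i := hS.mono_f
  have : Mono j := hS'.mono_f
  have : Epi p := hS.epi_g
  have : Epi q := hS'.epi_g
  have : Mono (biprod.lift p (-a)) := by
    refine Preadditive.mono_of_cancel_zero _ fun {T} t ht => ?_
    have htp : t ≫ p = 0 := by simpa using ht =≫ biprod.fst
    have hta : t ≫ a = 0 := by simpa using ht =≫ biprod.snd
    obtain ⟨s, rfl⟩ := KernelFork.IsLimit.lift' hS.fIsKernel _ htp
    have : s ≫ j = 0 := by simpa [← ha] using hta
    simp [zero_of_comp_mono j this]
  have : Epi (biprod.desc b q) :=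
    epi_of_epi_fac (f := biprod.inr) (h := q) (by simp)
  refine ⟨by simp [hb], ShortComplex.ShortExact.mk' ?_ ‹_› ‹_›⟩
  rw [ShortComplex.exact_iff_exact_up_to_refinements]
  intro A z hz
  dsimp at z hz
  obtain ⟨A', π, hπ, x, hx⟩ := surjective_up_to_refinements_of_epi p (z ≫ biprod.fst)
  have hz' : z ≫ biprod.fst ≫ b + z ≫ biprod.snd ≫ q = 0 := by
    simpa [biprod.desc_eq] using hz
  have hk : (π ≫ z ≫ biprod.snd + x ≫ a) ≫ q = 0 := by
    have hx' := hx =≫ b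
    simp only [Category.assoc, hb] at hx'
    simp only [Preadditive.add_comp, Category.assoc, ← hx']
    rw [← Preadditive.comp_add, add_comm, hz', comp_zero]
  obtain ⟨k, hk⟩ := KernelFork.IsLimit.lift' hS'.fIsKernel _ hk
  dsimp at hk
  refine ⟨A', π, hπ, x - k ≫ i, ?_⟩
  ext
  · simpa [w] using hx
  · simp [ha, hk]

omit [Abelian C] [CategoryTheory.HasExt.{w} C] in
lemma ClosedUnderSummands.mem_of_iso {XX : Set C} (h : ClosedUnderSummands XX) {X M : C}
    (hX : X ∈ XX) (e : X ≅ M) : M ∈ XX :=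
  h hX e.inv e.hom e.inv_hom_id

omit [CategoryTheory.HasExt.{w} C] in
lemma subset_resHat {XX : Set C} : XX ⊆ resHat XX :=
  fun X hX => ⟨0, .zero hX (Iso.refl X)⟩

lemma LeftFrobeniusPair.mem_of_hasResolutionLength {XX ωω : Set C}
    (hfrob : LeftFrobeniusPair XX ωω) {n : ℕ} {M : C} (hM : HasResolutionLength XX n M)
    (hperp : M ∈ leftPerp.{w} ωω) : M ∈ XX := by
  obtain ⟨⟨⟨hext, -⟩, hsum⟩, hinj, ⟨-, hcogen⟩, -⟩ := hfrob
  induction hM with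
  | zero hX e => exact hsum.mem_of_iso hX e
  | succ K X hX i p hse hK ih =>
    obtain ⟨w, hS⟩ := hse
    have hKX : K ∈ XX := ih fun W hW m hm =>
      subsingleton_ext_X₁ hS (hinj W hW X hX m hm) (hperp W hW (m + 1) m.succ_pos)
    obtain ⟨W, K', j, q, hW, hK', hse'⟩ := hcogen K hKX
    obtain ⟨a, ha⟩ := exists_extension hS (hperp W hW 1 one_pos) j
    have : Epi p := hS.epi_g
    have hw : i ≫ a ≫ q = 0 := by
      obtain ⟨w', -⟩ := hse'
      rw [← Category.assoc]
      exact ha ▸ w'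
    obtain ⟨b, hb⟩ := CokernelCofork.IsColimit.desc' hS.gIsCokernel (a ≫ q) hw
    exact hsum (hext _ _ (isShortExactSeq_biprod ⟨w, hS⟩ hse' ha hb) hX hK')
      biprod.inl biprod.fst biprod.inl_fst

lemma LeftFrobeniusPair.subsingleton_ext_of_hasResolutionLength {XX ωω : Set C}
    (hfrob : LeftFrobeniusPair.{w} XX ωω) {n : ℕ} {M : C} (hM : HasResolutionLength ωω n M)
    {X : C} (hX : X ∈ XX) {m : ℕ} (hm : 0 < m) : Subsingleton (Abelian.Ext.{w} X M m) := by
  induction hM generalizing m with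
  | zero hW e => exact hfrob.relInj _ (hfrob.summands.mem_of_iso hW e) X hX m hm
  | succ K W hW i p hse hK ih =>
    obtain ⟨w, hS⟩ := hse
    exact subsingleton_ext_X₃ hS (hfrob.relInj W hW X hX m hm) (ih m.succ_pos)

/-- Proposition AB12. For a left Frobenius pair `(X,ω)`:
`X^∧ ∩ ^⊥ω = X = X^∧ ∩ ^⊥(ω^∧)`. -/
theorem stmt9 (XX ωω : Set C) (hfrob : LeftFrobeniusPair XX ωω) :
    resHat XX ∩ leftPerp ωω = XX ∧ XX = resHat XX ∩ leftPerp (resHat ωω) := by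
  have hsub : ωω ⊆ resHat ωω := subset_resHat
  refine ⟨subset_antisymm ?_ ?_, subset_antisymm ?_ ?_⟩
  · rintro M ⟨⟨n, hM⟩, hperp⟩
    exact hfrob.mem_of_hasResolutionLength hM hperp
  · exact fun X hX => ⟨subset_resHat hX, fun W hW m hm => hfrob.relInj W hW X hX m hm⟩
  · exact fun X hX => ⟨subset_resHat hX, fun _ ⟨_, hW⟩ _ hm =>
      hfrob.subsingleton_ext_of_hasResolutionLength hW hX hm⟩
  · rintro M ⟨⟨n, hM⟩, hperp⟩
    exact hfrob.mem_of_hasResolutionLength hM fun W hW => hperp W (hsub hW)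

end ABFormal
end

section
/- Let C be an abelian category, S a thick class of objects of C, and (F,G) a pair of classes of objects of C. Then (F,G) is a left S-cotorsion pair in C if and only if the following three conditions hold: (scp1) F, G ⊆ S and F is closed under direct summands in C; (scp3) Ext^1_C(F,G) = 0 for all F ∈ F and G ∈ G; (scp4) every S ∈ S fits in a short exact sequence 0 → G → F → S → 0 with F ∈ F and G ∈ G. -/
/-!
Common definitions for Auslander–Buchweitz approximation theory in abelian
categories, following Becerril–Mendoza–Pérez–Santiago.
-/

open CategoryTheory CategoryTheory.Limits ZeroObject

universe w v u

namespace ABFormal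

variable {C : Type u} [Category.{v} C] [Abelian C] [CategoryTheory.HasExt.{w} C]

/-- Morphisms out of `A` lift along the epimorphism of a short exact sequence with kernel `K`
as soon as `Ext^1(A, K) = 0`. -/
lemma IsShortExactSeq.exists_lift {A K X Y : C} {i : K ⟶ X} {p : X ⟶ Y}
    (h : IsShortExactSeq i p) [Subsingleton (Abelian.Ext.{w} A K 1)] (f : A ⟶ Y) :
    ∃ g : A ⟶ X, g ≫ p = f := by
  obtain ⟨_, hse⟩ := h
  obtain ⟨x, hx⟩ := Abelian.Ext.covariant_sequence_exact₃ A hse (Abelian.Ext.mk₀ f)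
    (zero_add 1) (Subsingleton.elim (α := Abelian.Ext.{w} A K 1) _ _)
  obtain ⟨g, rfl⟩ := (Abelian.Ext.mk₀_bijective A X).2 x
  refine ⟨g, (Abelian.Ext.mk₀_bijective A Y).1 ?_⟩
  simpa only [Abelian.Ext.mk₀_comp_mk₀] using hx

/-- Vanishing of `Ext^n(-, Y)` passes to retracts. -/
lemma subsingleton_ext_of_retract {A X Y : C} {n : ℕ} (s : A ⟶ X) (r : X ⟶ A)
    (h : s ≫ r = 𝟙 A) [Subsingleton (Abelian.Ext.{w} X Y n)] :
    Subsingleton (Abelian.Ext.{w} A Y n) := by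
  refine Function.Injective.subsingleton
    (f := fun a ↦ (Abelian.Ext.mk₀ r).comp a (zero_add n)) fun a b hab ↦ ?_
  simpa [h] using congrArg (fun c ↦ (Abelian.Ext.mk₀ s).comp c (zero_add n)) hab

/-- Proposition CP1 (a). For a thick class `S` of `C`, a pair
`(F,G)` is a left `S`-cotorsion pair iff (scp1) `F, G ⊆ S` and `F` is closed under
direct summands; (scp3) `Ext^1(F,G) = 0`; (scp4) every `S ∈ S` admits an epic
`F`-precover with kernel in `G`. -/
theorem stmt12 (S F G : Set C) (hS : IsThickClass S) :
    IsLeftCotorsionPair S F G ↔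
      ((F ⊆ S ∧ G ⊆ S ∧ ClosedUnderSummands F) ∧
       (∀ F' ∈ F, ∀ G' ∈ G, Subsingleton (Abelian.Ext.{w} F' G' 1)) ∧
       (∀ s ∈ S, ∃ (K X : C) (i : K ⟶ X) (φ : X ⟶ s),
          K ∈ G ∧ IsShortExactSeq i φ ∧ IsPrecover F φ)) := by
  constructor
  · rintro ⟨hF, hG, hFeq, hseq⟩
    have hext : ∀ F' ∈ F, ∀ G' ∈ G, Subsingleton (Abelian.Ext.{w} F' G' 1) := by
      intro F' hF'
      rw [hFeq] at hF'
      exact hF'.2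
    refine ⟨⟨hF, hG, fun X A hX s r hsr ↦ ?_⟩, hext, fun s hs ↦ ?_⟩
    · rw [hFeq]
      refine ⟨hS.1.2 (hF hX) s r hsr, fun G' hG' ↦ ?_⟩
      have := hext X hX G' hG'
      exact subsingleton_ext_of_retract s r hsr
    · obtain ⟨K, X, i, p, hK, hX, hip⟩ := hseq s hs
      refine ⟨K, X, i, p, hK, hip, hX, fun X' hX' f ↦ ?_⟩
      have := hext X' hX' K hK
      exact hip.exists_lift f
  · rintro ⟨⟨hF, hG, hsum⟩, hext, hseq⟩
    refine ⟨hF, hG, Set.Subset.antisymm (fun A hA ↦ ⟨hF hA, hext A hA⟩) ?_, fun s hs ↦ ?_⟩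
    · rintro A ⟨hAS, hA⟩
      obtain ⟨K, X, i, p, hK, hip, hX, -⟩ := hseq A hAS
      have := hA K hK
      obtain ⟨g, hg⟩ := hip.exists_lift (𝟙 A)
      exact hsum hX g p hg
    · obtain ⟨K, X, i, p, hK, hip, hX, -⟩ := hseq s hs
      exact ⟨K, X, i, p, hK, hX, hip⟩

end ABFormal
end
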